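/- Let k ≥ 2 be an even integer and let m, n be integers with n ≥ m ≥ (k+2)² + 3. Then K(m−3,k−1)·K(n−3,k) ≤ k·K(m+n−3,k). -/

import Mathlib

/-- Cyclic distance between two indices on a cycle of length `N`. -/
def cycDist {N : ℕ} (i j : ZMod N) : ℕ := min (j - i).val (i - j).val

/-- A `(d,k)` circuit code of length `N`: a simple cycle `x₁,…,x_N` in the
`d`-dimensional hypercube graph `I(d)` (vertices are binary vectors of length
`d`, adjacency is Hamming distance `1`, and the graph distance in `I(d)` equals
the Hamming distance) such that for any two vertices of the cycle the graph
distance is at least the minimum of their distance along the cycle and `k`. -/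
def IsCircuitCode (d k N : ℕ) (x : ZMod N → (Fin d → Bool)) : Prop :=
  3 ≤ N ∧ Function.Injective x ∧
    (∀ i : ZMod N, hammingDist (x i) (x (i + 1)) = 1) ∧
    (∀ i j : ZMod N, min (cycDist i j) k ≤ hammingDist (x i) (x j))

/-- `K d k`: the maximum length of a `(d,k)` circuit code. -/
noncomputable def K (d k : ℕ) : ℕ :=
  sSup {N | ∃ x : ZMod N → (Fin d → Bool), IsCircuitCode d k N x}

section Hamming

variable {ι κ : Type*} [Fintype ι] [Fintype κ]

theorem hammingDist_eq_sum_ite (x y : ι → Bool) :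
    hammingDist x y = ∑ i, if x i ≠ y i then 1 else 0 := by
  simp [hammingDist, Finset.card_filter]

theorem hammingDist_sumElim (f f' : ι → Bool) (g g' : κ → Bool) :
    hammingDist (Sum.elim f g) (Sum.elim f' g') = hammingDist f f' + hammingDist g g' := by
  simp only [hammingDist_eq_sum_ite, Fintype.sum_sum_type, Sum.elim_inl, Sum.elim_inr]
  rfl

theorem hammingDist_comp_equiv (e : κ ≃ ι) (x y : ι → Bool) :
    hammingDist (x ∘ e) (y ∘ e) = hammingDist x y := by
  simp only [hammingDist_eq_sum_ite, Function.comp_apply]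
  exact e.sum_comp fun i => if x i ≠ y i then 1 else 0

theorem even_hammingDist_triple (x y z : ι → Bool) :
    Even (hammingDist x y + hammingDist y z + hammingDist x z) := by
  simp only [hammingDist_eq_sum_ite, ← Finset.sum_add_distrib]
  refine Finset.even_sum _ fun i _ => ?_
  cases x i <;> cases y i <;> cases z i <;> decide

/-- Along a walk in the hypercube the Hamming distance has the parity of the number of steps. -/
theorem hammingDist_walk_mod_two {x : ℕ → ι → Bool}
    (hx : ∀ t, hammingDist (x t) (x (t + 1)) = 1) (s n : ℕ) :
    hammingDist (x s) (x (s + n)) % 2 = n % 2 := by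
  induction n with
  | zero => simp
  | succ n ih =>
    have h := even_hammingDist_triple (x s) (x (s + n)) (x (s + n + 1))
    rw [hx, Nat.even_iff] at h
    rw [← add_assoc]
    omega

theorem hammingDist_walk_le {x : ℕ → ι → Bool}
    (hx : ∀ t, hammingDist (x t) (x (t + 1)) = 1) (s n : ℕ) :
    hammingDist (x s) (x (s + n)) ≤ n := by
  induction n with
  | zero => simp
  | succ n ih =>
    have h := hammingDist_triangle (x s) (x (s + n)) (x (s + n + 1))
    rw [hx] at h
    rw [← add_assoc]
    omega

/-- Two adjacent vertices agree except at one coordinate. -/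
theorem exists_flip_of_hammingDist_eq_one {x y : ι → Bool} (h : hammingDist x y = 1) :
    ∃ i, x i ≠ y i ∧ ∀ j, j ≠ i → x j = y j := by
  obtain ⟨i, hi⟩ := Finset.card_eq_one.mp h
  have key : ∀ j, x j ≠ y j ↔ j = i := fun j => by
    simpa using Finset.ext_iff.mp hi j
  exact ⟨i, (key i).mpr rfl, fun j hj => not_not.mp fun hne => hj ((key j).mp hne)⟩

/-- Flipping a coordinate on which two vertices agree increases their distance by one. -/
theorem hammingDist_flip {x y z : ι → Bool} {i : ι} (hxy : x i = y i) (hi : y i ≠ z i)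
    (hj : ∀ j, j ≠ i → y j = z j) : hammingDist x z = hammingDist x y + 1 := by
  classical
  rw [hammingDist_eq_sum_ite, hammingDist_eq_sum_ite,
    ← Finset.add_sum_erase _ _ (Finset.mem_univ i),
    ← Finset.add_sum_erase Finset.univ (fun i => if x i ≠ y i then 1 else 0) (Finset.mem_univ i),
    Finset.sum_congr rfl fun j hj' => by rw [← hj j (Finset.ne_of_mem_erase hj')]]
  simp only [hxy, ne_eq, not_true_eq_false, if_false, hi, not_false_eq_true, if_true]
  ring

end Hamming

/-- A closed walk of length `L` in the hypercube, indexed periodically by `ℕ`, in which vertices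
at least `k` apart along the cycle have Hamming distance at least `k`. -/
structure IsSpreadCycle {ι : Type*} [Fintype ι] (k L : ℕ) (x : ℕ → ι → Bool) : Prop where
  periodic : ∀ t, x (t + L) = x t
  step : ∀ t, hammingDist (x t) (x (t + 1)) = 1
  spread : ∀ s t, s + k ≤ t → t + k ≤ s + L → k ≤ hammingDist (x s) (x t)

namespace IsSpreadCycle

variable {ι κ : Type*} [Fintype ι] [Fintype κ] {k L : ℕ} {x : ℕ → ι → Bool}

theorem sub_le_hammingDist (h : IsSpreadCycle k L x) (hL : 2 * k ≤ L) {s t : ℕ} (hst : s ≤ t)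
    (htk : t ≤ s + k) : t - s ≤ hammingDist (x s) (x t) := by
  have h1 := h.spread s (s + k) le_rfl (by omega)
  have h2 := hammingDist_walk_le h.step t (s + k - t)
  rw [Nat.add_sub_cancel' htk] at h2
  have h3 := hammingDist_triangle (x s) (x t) (x (s + k))
  omega

theorem min_le_hammingDist (h : IsSpreadCycle k L x) (hL : 2 * k ≤ L) {s t : ℕ} (hst : s ≤ t)
    (htL : t ≤ s + L) : min (min (t - s) (s + L - t)) k ≤ hammingDist (x s) (x t) := by
  rcases le_total t (s + k) with h1 | h1
  · have := h.sub_le_hammingDist hL hst h1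
    omega
  rcases le_total (t + k) (s + L) with h2 | h2
  · have := h.spread s t h1 h2
    omega
  · have := h.sub_le_hammingDist hL htL (by omega)
    rw [h.periodic, hammingDist_comm] at this
    omega

theorem mono (h : IsSpreadCycle k L x) (hL : 2 * k ≤ L) {l : ℕ} (hl : l ≤ k) :
    IsSpreadCycle l L x :=
  ⟨h.periodic, h.step, fun s t h1 h2 => by
    have := h.min_le_hammingDist hL (s := s) (t := t) (by omega) (by omega)
    omega⟩

theorem even_length (h : IsSpreadCycle k L x) : Even L := by
  have h1 := hammingDist_walk_mod_two h.step 0 L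
  rw [h.periodic, hammingDist_self] at h1
  exact Nat.even_iff.mpr h1.symm

theorem apply_add_mul (h : IsSpreadCycle k L x) (t n : ℕ) : x (t + n * L) = x t := by
  induction n with
  | zero => simp
  | succ n ih => rw [Nat.succ_mul, ← add_assoc, h.periodic, ih]

theorem apply_mod (h : IsSpreadCycle k L x) (t : ℕ) : x (t % L) = x t := by
  conv_rhs => rw [← Nat.mod_add_div' t L]
  exact (h.apply_add_mul _ _).symm

theorem comp_equiv (h : IsSpreadCycle k L x) (e : κ ≃ ι) :
    IsSpreadCycle k L fun t => x t ∘ e :=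
  ⟨fun t => by rw [h.periodic], fun t => by rw [hammingDist_comp_equiv, h.step],
    fun s t h1 h2 => by rw [hammingDist_comp_equiv]; exact h.spread s t h1 h2⟩

end IsSpreadCycle

theorem length_le_of_isCircuitCode {d k N : ℕ} {x : ZMod N → Fin d → Bool}
    (h : IsCircuitCode d k N x) : N ≤ 2 ^ d := by
  obtain ⟨h3, hinj, -⟩ := h
  have : NeZero N := ⟨by omega⟩
  simpa [ZMod.card] using Fintype.card_le_of_injective x hinj

theorem bddAbove_circuitCode_lengths (d k : ℕ) :
    BddAbove {N | ∃ x : ZMod N → Fin d → Bool, IsCircuitCode d k N x} :=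
  ⟨2 ^ d, fun _ ⟨_, hx⟩ => length_le_of_isCircuitCode hx⟩

theorem cycDist_comm {N : ℕ} (i j : ZMod N) : cycDist i j = cycDist j i := min_comm _ _

theorem cycDist_eq_of_val_le {N : ℕ} [NeZero N] {i j : ZMod N} (h : i.val ≤ j.val) (hne : i ≠ j) :
    cycDist i j = min (j.val - i.val) (i.val + N - j.val) := by
  have hj := ZMod.val_lt j
  have h1 : (j - i).val = j.val - i.val := ZMod.val_sub h
  have h2 : (i - j).val = N - (j - i).val := by
    rw [← neg_sub, ZMod.neg_val, if_neg (sub_ne_zero.mpr hne.symm)]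
  rw [cycDist, h2, h1]
  congr 1
  omega

theorem IsSpreadCycle.length_le_K {ι : Type*} [Fintype ι] {d k L : ℕ} {x : ℕ → ι → Bool}
    (h : IsSpreadCycle k L x) (hk : 1 ≤ k) (hL : 2 * k ≤ L) (h3 : 3 ≤ L)
    (hd : Fintype.card ι = d) : L ≤ K d k := by
  have e : Fin d ≃ ι := (Fintype.equivFinOfCardEq hd).symm
  have : NeZero L := ⟨by omega⟩
  obtain ⟨y, hy⟩ : ∃ y : ℕ → Fin d → Bool, IsSpreadCycle k L y := ⟨_, h.comp_equiv e⟩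
  have hdist : ∀ i j : ZMod L, i ≠ j →
      min (cycDist i j) k ≤ hammingDist (y i.val) (y j.val) := by
    intro i j hne
    have hi := ZMod.val_lt i
    have hj := ZMod.val_lt j
    rcases le_total i.val j.val with hij | hij
    · rw [cycDist_eq_of_val_le hij hne]
      exact hy.min_le_hammingDist hL hij (by omega)
    · rw [cycDist_comm, cycDist_eq_of_val_le hij hne.symm, hammingDist_comm]
      exact hy.min_le_hammingDist hL hij (by omega)
  refine le_csSup (bddAbove_circuitCode_lengths d k)
    ⟨fun i => y i.val, h3, fun i j hij => ?_, fun i => ?_, fun i j => ?_⟩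
  · by_contra hne
    have h1 := hdist i j hne
    have h2 : y i.val = y j.val := hij
    rw [h2, hammingDist_self] at h1
    have h4 : (j - i).val ≠ 0 := fun h0 =>
      hne (sub_eq_zero.mp ((ZMod.val_eq_zero _).mp h0)).symm
    have h5 : (i - j).val ≠ 0 := fun h0 =>
      hne (sub_eq_zero.mp ((ZMod.val_eq_zero _).mp h0))
    rw [cycDist] at h1
    omega
  · have : (i + 1).val = (i.val + 1) % L := by
      rw [ZMod.val_add, ZMod.val_one'' (by omega)]
    simp only [this]
    rw [hy.apply_mod, hy.step]
  · rcases eq_or_ne i j with rfl | hne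
    · simp [cycDist]
    · exact hdist i j hne

theorem IsCircuitCode.isSpreadCycle {d k N : ℕ} {x : ZMod N → Fin d → Bool}
    (h : IsCircuitCode d k N x) : IsSpreadCycle k N fun t => x t := by
  obtain ⟨h3, -, hstep, hspread⟩ := h
  have : NeZero N := ⟨by omega⟩
  refine ⟨fun t => by simp, fun t => by simpa using hstep t, fun s t h1 h2 => ?_⟩
  rcases Nat.eq_zero_or_pos k with rfl | hk
  · simp
  refine le_trans (le_min (le_min ?_ ?_) le_rfl) (hspread s t)
  · have : (t : ZMod N) - s = ((t - s : ℕ) : ZMod N) := by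
      rw [Nat.cast_sub (by omega)]
    rw [this, ZMod.val_cast_of_lt (by omega)]
    omega
  · have : (s : ZMod N) - t = ((s + N - t : ℕ) : ZMod N) := by
      rw [Nat.cast_sub (by omega)]
      simp
    rw [this, ZMod.val_cast_of_lt (by omega)]
    omega

theorem exists_isSpreadCycle_K {d k : ℕ} (h : 0 < K d k) :
    ∃ x : ℕ → Fin d → Bool, IsSpreadCycle k (K d k) x := by
  have hne : {N | ∃ x : ZMod N → Fin d → Bool, IsCircuitCode d k N x}.Nonempty := by
    by_contra hempty
    rw [Set.not_nonempty_iff_eq_empty] at hempty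
    simp [K, hempty] at h
  obtain ⟨x, hx⟩ := Nat.sSup_mem hne (bddAbove_circuitCode_lengths d k)
  exact ⟨_, hx.isSpreadCycle⟩

/-- The cycle of length `2 * b` in the `b`-cube that flips the coordinates cyclically. -/
def rotationCycle (b : ℕ) (t : ℕ) (i : Fin b) : Bool :=
  decide ((t + i) / b % 2 = 1)

theorem isSpreadCycle_rotationCycle {b : ℕ} (hb : 0 < b) :
    IsSpreadCycle b (2 * b) (rotationCycle b) := by
  have hdiv : ∀ t i : ℕ, (t + b + i) / b = (t + i) / b + 1 := fun t i => by
    rw [add_right_comm, Nat.add_div_right _ hb]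
  refine ⟨fun t => ?_, fun t => ?_, fun s t h1 h2 => ?_⟩
  · funext i
    have h1 : (t + 2 * b + i) / b = (t + i) / b + 2 := by
      rw [two_mul, ← add_assoc, hdiv, hdiv]
    simp only [rotationCycle, h1, Nat.add_mod_right]
  · have hlt : b - 1 - t % b < b := by omega
    refine Finset.card_eq_one.mpr ⟨⟨b - 1 - t % b, hlt⟩, ?_⟩
    ext i
    have hdvd : b ∣ t + i + 1 ↔ (i : ℕ) = b - 1 - t % b := by
      have hi := i.isLt
      have ht := Nat.mod_lt t hb
      have hsum : t + i + 1 = t % b + i + 1 + b * (t / b) := by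
        have := Nat.mod_add_div t b
        omega
      rw [hsum, Nat.dvd_add_left (dvd_mul_right _ _)]
      constructor
      · rintro ⟨c, hc⟩
        have : c = 1 := by
          rcases c with _ | _ | c
          · omega
          · rfl
          · have : b * (c + 1 + 1) = b * c + 2 * b := by ring
            have := Nat.zero_le (b * c)
            omega
        subst this
        omega
      · intro h
        exact ⟨1, by omega⟩
    simp only [Finset.mem_filter, Finset.mem_univ, true_and, Finset.mem_singleton, Fin.ext_iff,
      rotationCycle, ← hdvd, add_right_comm t 1, Nat.succ_div]
    by_cases h : b ∣ t + i + 1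
    · simp only [h, if_true, iff_true, ne_eq, decide_eq_decide]
      omega
    · simp [h]
  · obtain rfl : t = s + b := by omega
    have hne : ∀ i, rotationCycle b s i ≠ rotationCycle b (s + b) i := fun i => by
      simp only [rotationCycle, hdiv, ne_eq, decide_eq_decide]
      omega
    simp [hammingDist, hne]

/-- Spreading `r` flips of one new coordinate evenly along a cycle lengthens it by `r`. -/
theorem IsSpreadCycle.exists_lengthen {ι : Type*} [Fintype ι] {k M r : ℕ} {x : ℕ → ι → Bool}
    (h : IsSpreadCycle k M x) (hM : 2 * k ≤ M) (hr : Even r) (hrM : r * k ≤ M) (hpos : 0 < M) :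
    ∃ y : ℕ → ι ⊕ Unit → Bool, IsSpreadCycle k (M + r) y := by
  obtain ⟨V, hVper, hV1, hV2, hVk⟩ : ∃ V : ℕ → ℕ, (∀ t, V (t + (M + r)) = V t + r) ∧
      (∀ t, V t ≤ V (t + 1)) ∧ (∀ t, V (t + 1) ≤ V t + 1) ∧
      ∀ t, V (t + (k + 1)) ≤ V t + 1 := by
    have hincr : ∀ t n, n * r ≤ M + r → (t + n) * r / (M + r) ≤ t * r / (M + r) + 1 := by
      intro t n hn
      rw [← Nat.add_div_right _ (by omega : 0 < M + r)]
      exact Nat.div_le_div_right (by rw [add_mul]; omega)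
    refine ⟨fun t => t * r / (M + r), fun t => ?_, fun t => ?_, fun t => ?_, fun t => ?_⟩
    · change (t + (M + r)) * r / (M + r) = t * r / (M + r) + r
      rw [add_mul, Nat.add_mul_div_left _ _ (by omega)]
    · exact Nat.div_le_div_right (Nat.mul_le_mul_right _ (by omega))
    · exact hincr t 1 (by omega)
    · exact hincr t (k + 1) (by rw [add_mul, mul_comm k]; omega)
  have hVmono : Monotone V := monotone_nat_of_le_succ hV1
  obtain ⟨P, hP⟩ : ∃ P : ℕ → ℕ, ∀ t, P t + V t = t + V 0 := by
    refine ⟨fun t => t + V 0 - V t, fun t => Nat.sub_add_cancel ?_⟩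
    induction t with
    | zero => simp
    | succ t ih =>
      have := hV2 t
      omega
  have hPmono : Monotone P := monotone_nat_of_le_succ fun t => by
    have h1 := hP t
    have h2 := hP (t + 1)
    have h3 := hV2 t
    omega
  have hPper : ∀ t, P (t + (M + r)) = P t + M := fun t => by
    have h1 := hP t
    have h2 := hP (t + (M + r))
    have h3 := hVper t
    omega
  obtain ⟨y, hy⟩ : ∃ y : ℕ → ι ⊕ Unit → Bool,
      ∀ t, y t = Sum.elim (x (P t)) fun _ => decide (V t % 2 = 1) := ⟨_, fun _ => rfl⟩
  have hbit : ∀ s t, V s ≤ V t → V t ≤ V s + 1 →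
      hammingDist (fun _ : Unit => decide (V s % 2 = 1)) (fun _ => decide (V t % 2 = 1))
        = V t - V s := by
    intro s t h1 h2
    rw [hammingDist_eq_sum_ite]
    simp only [Finset.univ_unique, Finset.sum_singleton, ne_eq, decide_eq_decide]
    split_ifs <;> omega
  have hper : ∀ t, y (t + (M + r)) = y t := fun t => by
    rw [Nat.even_iff] at hr
    rw [hy, hy, hPper, h.periodic, hVper, Nat.add_mod, hr, add_zero, Nat.mod_mod]
  have near : ∀ s t, s ≤ t → P t < P s + k → t ≤ s + hammingDist (y s) (y t) := by
    intro s t hst hlt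
    have hVle : V t ≤ V s + 1 := by
      by_contra hcon
      have h1 := hVk s
      rcases le_total t (s + (k + 1)) with h2 | h2
      · have := hVmono h2
        omega
      · have h3 := hPmono h2
        have h4 := hP s
        have h5 := hP (s + (k + 1))
        omega
    rw [hy, hy, hammingDist_sumElim, hbit s t (hVmono hst) hVle]
    have h1 := h.sub_le_hammingDist hM (hPmono hst) hlt.le
    have h2 := hP s
    have h3 := hP t
    have h4 := hPmono hst
    have h5 := hVmono hst
    omega
  refine ⟨y, hper, fun t => ?_, fun s t h1 h2 => ?_⟩
  · rw [hy, hy, hammingDist_sumElim, hbit t (t + 1) (hV1 t) (hV2 t)]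
    have h1 := hP t
    have h2 := hP (t + 1)
    have h3 := hV1 t
    rcases (hV2 t).lt_or_eq with h4 | h4
    · rw [show P (t + 1) = P t + 1 by omega, h.step]
      omega
    · rw [show P (t + 1) = P t by omega, hammingDist_self]
      omega
  · rcases lt_or_ge (P t) (P s + k) with h3 | h3
    · have := near s t (by omega) h3
      omega
    rcases lt_or_ge (P (s + (M + r))) (P t + k) with h4 | h4
    · have := near t (s + (M + r)) (by omega) h4
      rw [hper, hammingDist_comm] at this
      omega
    · rw [hPper] at h4
      rw [hy, hy, hammingDist_sumElim]
      have := h.spread _ _ h3 h4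
      omega

/-- The Hamming distances between the auxiliary two-bit labels: constant labels encode the parity
of a vertex at rest, the two non-constant labels mark vertices in transit. -/
theorem hammingDist_const_const (a b : Bool) :
    hammingDist (fun _ : Bool => a) (fun _ => b) = if a = b then 0 else 2 := by
  revert a b; decide

theorem hammingDist_const_xor (a b : Bool) :
    hammingDist (fun _ : Bool => a) (fun z => xor z b) = 1 := by
  revert a b; decide

theorem hammingDist_xor_const (a b : Bool) :
    hammingDist (fun z => xor z b) (fun _ : Bool => a) = 1 := by
  revert a b; decide

theorem hammingDist_xor_xor (a b : Bool) :
    hammingDist (fun z => xor z a) (fun z => xor z b) = if a = b then 0 else 2 := by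
  revert a b; decide

/-- The position at time `t` of a walk which moves along a long cycle and, on reaching position
`lam n` of it, pauses for three steps to perform the `n`-th crossing: `n` crossings are complete,
`Q` is the position on the long cycle and `o` the number of steps done of the current crossing. -/
structure HelixState (lam : ℕ → ℕ) (t n Q o : ℕ) : Prop where
  time : t = 3 * n + Q + o
  phase_le : o ≤ 2
  pos_le : Q ≤ lam n
  pos_eq : 0 < o → Q = lam n
  le_pos : ∀ m < n, lam m ≤ Q

namespace HelixState

variable {lam : ℕ → ℕ} {s t n n' Q Q' o o' : ℕ}

theorem succ (h : HelixState lam t n Q o) (hlam : Monotone lam) :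
    (Q < lam n ∧ o = 0 ∧ HelixState lam (t + 1) n (Q + 1) 0) ∨
      (Q = lam n ∧ o < 2 ∧ HelixState lam (t + 1) n Q (o + 1)) ∨
      (Q = lam n ∧ o = 2 ∧ HelixState lam (t + 1) (n + 1) Q 0) := by
  obtain ⟨h1, h2, h3, h4, h5⟩ := h
  rcases h3.lt_or_eq with h6 | h6
  · have : o = 0 := by omega
    exact Or.inl ⟨h6, this, by omega, by omega, h6, by omega,
      fun m hm => (h5 m hm).trans (by omega)⟩
  · rcases h2.lt_or_eq with h7 | h7
    · exact Or.inr (Or.inl ⟨h6, h7, by omega, by omega, h3, fun _ => h6, h5⟩)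
    · exact Or.inr (Or.inr ⟨h6, h7, by omega, by omega, h3.trans (hlam (by omega)), by omega,
        fun m hm => (hlam (by omega : m ≤ n)).trans h6.ge⟩)

theorem exists_state (hlam : Monotone lam) (t : ℕ) : ∃ n Q o, HelixState lam t n Q o := by
  induction t with
  | zero => exact ⟨0, 0, 0, rfl, by omega, by omega, by omega, by omega⟩
  | succ t ih =>
    obtain ⟨n, Q, o, h⟩ := ih
    rcases h.succ hlam with ⟨-, -, h⟩ | ⟨-, -, h⟩ | ⟨-, -, h⟩ <;> exact ⟨_, _, _, h⟩

theorem count_le (h : HelixState lam s n Q o) (h' : HelixState lam t n' Q' o') (hst : s ≤ t) :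
    n ≤ n' := by
  by_contra hcon
  have h1 := h.le_pos n' (by omega)
  have h2 := h.time
  have h3 := h'.time
  have h4 := h'.pos_le
  have h5 := h'.phase_le
  omega

theorem pos_mono (h : HelixState lam s n Q o) (h' : HelixState lam t n' Q' o') (hst : s ≤ t) :
    Q ≤ Q' := by
  have h1 := h.time
  have h2 := h'.time
  have h3 := h.pos_le
  have h4 := h'.pos_eq
  rcases (h.count_le h' hst).lt_or_eq with hn | rfl
  · exact h3.trans (h'.le_pos n hn)
  · omega

theorem unique (h : HelixState lam t n Q o) (h' : HelixState lam t n' Q' o') :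
    n = n' ∧ Q = Q' ∧ o = o' := by
  have h1 := h.count_le h' le_rfl
  have h2 := h'.count_le h le_rfl
  have h3 := h.pos_mono h' le_rfl
  have h4 := h'.pos_mono h le_rfl
  have h5 := h.time
  have h6 := h'.time
  omega

end HelixState

section Helix

variable {α β : Type*} [Fintype α] [Fintype β]

/-- The label attached to a helix state. -/
def helixLabel (e : ℕ → Bool) (n o : ℕ) : Bool → Bool :=
  if o = 0 then fun _ => decide (n % 2 = 1) else fun z => xor z (e n)

/-- The vertex of the product cube attached to a helix state. -/
def helixVertex (A : ℕ → α → Bool) (B : ℕ → β → Bool) (e : ℕ → Bool) (n Q o : ℕ) :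
    α ⊕ β ⊕ Bool → Bool :=
  Sum.elim (A (if o = 2 then n + 1 else n)) (Sum.elim (B Q) (helixLabel e n o))

theorem hammingDist_helixVertex (A : ℕ → α → Bool) (B : ℕ → β → Bool) (e : ℕ → Bool)
    (n Q o n' Q' o' : ℕ) :
    hammingDist (helixVertex A B e n Q o) (helixVertex A B e n' Q' o') =
      hammingDist (A (if o = 2 then n + 1 else n)) (A (if o' = 2 then n' + 1 else n')) +
        (hammingDist (B Q) (B Q') + hammingDist (helixLabel e n o) (helixLabel e n' o')) := by
  simp only [helixVertex, hammingDist_sumElim]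

theorem hammingDist_helixLabel_rest_rest (e : ℕ → Bool) (n n' : ℕ) :
    hammingDist (helixLabel e n 0) (helixLabel e n' 0) = if n % 2 = n' % 2 then 0 else 2 := by
  simp only [helixLabel, if_true, hammingDist_const_const, decide_eq_decide]
  split_ifs <;> omega

theorem hammingDist_helixLabel_rest_transit (e : ℕ → Bool) (n n' : ℕ) {o : ℕ} (ho : 0 < o) :
    hammingDist (helixLabel e n 0) (helixLabel e n' o) = 1 := by
  simp only [helixLabel, if_true, if_neg ho.ne', hammingDist_const_xor]

theorem hammingDist_helixLabel_transit_rest (e : ℕ → Bool) (n n' : ℕ) {o : ℕ} (ho : 0 < o) :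
    hammingDist (helixLabel e n o) (helixLabel e n' 0) = 1 := by
  simp only [helixLabel, if_true, if_neg ho.ne', hammingDist_xor_const]

theorem hammingDist_helixLabel_transit_transit (e : ℕ → Bool) (n n' : ℕ) {o o' : ℕ} (ho : 0 < o)
    (ho' : 0 < o') :
    hammingDist (helixLabel e n o) (helixLabel e n' o') = if e n = e n' then 0 else 2 := by
  simp only [helixLabel, if_neg ho.ne', if_neg ho'.ne', hammingDist_xor_xor]

theorem hammingDist_helixVertex_succ {A : ℕ → α → Bool} {B : ℕ → β → Bool} {e : ℕ → Bool}
    {lam : ℕ → ℕ} {t n Q o n' Q' o' : ℕ} (hA : ∀ t, hammingDist (A t) (A (t + 1)) = 1)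
    (hB : ∀ t, hammingDist (B t) (B (t + 1)) = 1) (hlam : Monotone lam)
    (h : HelixState lam t n Q o) (h' : HelixState lam (t + 1) n' Q' o') :
    hammingDist (helixVertex A B e n Q o) (helixVertex A B e n' Q' o') = 1 := by
  rw [hammingDist_helixVertex]
  rcases h.succ hlam with ⟨-, rfl, h1⟩ | ⟨-, ho, h1⟩ | ⟨-, rfl, h1⟩ <;>
    obtain ⟨rfl, rfl, rfl⟩ := h'.unique h1
  · simp [hB]
  · interval_cases o
    · simp [hammingDist_helixLabel_rest_transit]
    · simp [hammingDist_helixLabel_transit_transit, hA]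
  · simp [hammingDist_helixLabel_transit_rest]

/-- Helix states whose positions are less than `k` apart are not brought closer together. -/
theorem sub_le_hammingDist_helixVertex {A : ℕ → α → Bool} {B : ℕ → β → Bool} {e : ℕ → Bool}
    {lam : ℕ → ℕ} {k N s t n Q o n' Q' o' : ℕ}
    (hA : ∀ t, hammingDist (A t) (A (t + 1)) = 1) (hB : IsSpreadCycle k N B) (hN : 2 * k ≤ N)
    (hlam : ∀ m n, m < n → lam m + k ≤ lam n)
    (h : HelixState lam s n Q o) (h' : HelixState lam t n' Q' o') (hst : s ≤ t)
    (hQ : Q' < Q + k) :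
    t - s ≤ hammingDist (helixVertex A B e n Q o) (helixVertex A B e n' Q' o') := by
  have hn := h.count_le h' hst
  have hQQ := h.pos_mono h' hst
  have hBd := hB.sub_le_hammingDist hN hQQ hQ.le
  have h1 := h.time
  have h2 := h'.time
  have h3 := h.pos_le
  have h4 := h'.pos_eq
  have h5 := h.phase_le
  have h6 := h'.phase_le
  have h9 := h.pos_eq
  have hn' : n' ≤ n + 1 := by
    by_contra hcon
    have h7 := h'.le_pos (n + 1) (by omega)
    have h8 := hlam n (n + 1) (by omega)
    omega
  rw [hammingDist_helixVertex]
  obtain rfl | rfl : n' = n ∨ n' = n + 1 := by omega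
  · have h10 := h'.pos_le
    have hoo : o ≤ o' := by omega
    have key : o' - o ≤ hammingDist (A (if o = 2 then n' + 1 else n'))
        (A (if o' = 2 then n' + 1 else n')) +
          hammingDist (helixLabel e n' o) (helixLabel e n' o') := by
      interval_cases o <;> interval_cases o' <;>
        simp [hammingDist_helixLabel_rest_transit, hA]
    omega
  · obtain rfl : o' = 0 := by
      by_contra hcon
      have h7 := hlam n (n + 1) (by omega)
      have h8 := h4 (by omega)
      omega
    have key : 3 - o ≤ hammingDist (A (if o = 2 then n + 1 else n))
        (A (if 0 = 2 then n + 1 + 1 else n + 1)) +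
          hammingDist (helixLabel e n o) (helixLabel e (n + 1) 0) := by
      interval_cases o
      · have : ¬ n % 2 = (n + 1) % 2 := by omega
        simp [hammingDist_helixLabel_rest_rest, hA, this]
      · simp [hammingDist_helixLabel_transit_rest, hA]
      · simp [hammingDist_helixLabel_transit_rest]
    omega

/-- Helix states that are a positive number `r < R` of turns apart have distance at least `k`. -/
theorem le_hammingDist_helixVertex_of_turns {A : ℕ → α → Bool} {B : ℕ → β → Bool} {e : ℕ → Bool}
    {c b : ℕ → ℕ} {k R N C r s t n Q o n' Q' o' : ℕ} (hk : Even k)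
    (hA : IsSpreadCycle (k - 1) (k * R) A) (hB : IsSpreadCycle k N B) (hN : 2 * k ≤ N)
    (hc : ∀ n, c n < C) (hb : ∀ m n, m < n → b m + C + k ≤ b n + 1)
    (hbr : ∀ m r, b (m + r * k) = b m + r * N)
    (hsep : ∀ n r, 1 ≤ r → r < R → c n = c (n + r * k) → e n = e (n + r * k) →
      k ≤ hammingDist (A n) (A (n + r * k + 1)) ∧ k ≤ hammingDist (A (n + 1)) (A (n + r * k)))
    (h : HelixState (fun m => b m + c m) s n Q o)
    (h' : HelixState (fun m => b m + c m) t n' Q' o')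
    (hr : 1 ≤ r) (hrR : r < R) (hn : 1 ≤ n) (hn' : 1 ≤ n') (hQ1 : Q' < Q + r * N + k)
    (hQ2 : Q + r * N < Q' + k) :
    k ≤ hammingDist (helixVertex A B e n Q o) (helixVertex A B e n' Q' o') := by
  have window : ∀ {t n Q o : ℕ}, HelixState (fun m => b m + c m) t n Q o → 1 ≤ n →
      ∃ p, (if o = 2 then n + 1 else n) = p + 1 ∧ b p ≤ Q ∧ Q + 1 ≤ b (p + 1) + C := by
    intro t n Q o h hn
    have h1 := h.pos_le
    have h2 := hc n
    have h3 := h.le_pos (n - 1) (by omega)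
    split_ifs with ho
    · have h4 := h.pos_eq (by omega)
      have h5 := hb n (n + 1) (by omega)
      exact ⟨n, rfl, by omega, by omega⟩
    · refine ⟨n - 1, by omega, by omega, ?_⟩
      rw [Nat.sub_add_cancel hn]
      omega
  obtain ⟨p, hp, hp1, hp2⟩ := window h hn
  obtain ⟨p', hp', hp1', hp2'⟩ := window h' hn'
  have hrk : 1 * k ≤ r * k := Nat.mul_le_mul_right k hr
  have hrkR : r * k + k ≤ k * R := by
    have : (r + 1) * k ≤ R * k := Nat.mul_le_mul_right k hrR
    rw [add_mul, mul_comm R] at this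
    omega
  have hle : p' ≤ p + r * k + 1 := by
    by_contra hcon
    have h1 := hb (p + 1 + r * k) p' (by omega)
    have h2 := hbr (p + 1) r
    omega
  have hge : p + r * k ≤ p' + 1 := by
    by_contra hcon
    have h1 := hb (p' + 1) (p + r * k) (by omega)
    have h2 := hbr p r
    omega
  have heven : (r * k) % 2 = 0 := Nat.even_iff.mp (hk.mul_left r)
  have hk2 : k % 2 = 0 := Nat.even_iff.mp hk
  have hAd := hA.spread (p + 1) (p' + 1) (by omega) (by omega)
  rw [hammingDist_helixVertex, hp, hp']
  rcases eq_or_ne p' (p + r * k) with heq | hne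
  · have h1 := hammingDist_walk_mod_two hA.step (p + 1) (r * k)
    rw [show p + 1 + r * k = p' + 1 by omega] at h1
    omega
  rcases eq_or_ne Q' (Q + r * N) with hQ | hQ
  swap
  · have hBd : 1 ≤ hammingDist (B Q) (B Q') := by
      rw [← hB.apply_add_mul Q r]
      rcases lt_or_gt_of_ne hQ with h1 | h1
      · have := hB.sub_le_hammingDist hN h1.le hQ2.le
        rw [hammingDist_comm] at this
        omega
      · have := hB.sub_le_hammingDist hN h1.le hQ1.le
        omega
    omega
  rcases Nat.eq_zero_or_pos o with rfl | ho <;> rcases Nat.eq_zero_or_pos o' with rfl | ho'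
  · rw [hammingDist_helixLabel_rest_rest, if_neg]
    · omega
    · simp only [OfNat.zero_ne_ofNat, if_false] at hp hp'
      omega
  · rw [hammingDist_helixLabel_rest_transit e n n' ho']
    omega
  · rw [hammingDist_helixLabel_transit_rest e n n' ho]
    omega
  · rw [hammingDist_helixLabel_transit_transit e n n' ho ho']
    split_ifs with he
    · have h1 := h.pos_eq ho
      have h2 := h'.pos_eq ho'
      have h3 := hbr n r
      have h4 := hc n
      have h5 := hc n'
      obtain rfl : n' = n + r * k := by
        rcases lt_trichotomy n' (n + r * k) with h6 | h6 | h6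
        · have := hb _ _ h6
          omega
        · exact h6
        · have := hb _ _ h6
          omega
      obtain ⟨h6, h7⟩ := hsep n r hr hrR (by omega) he
      rw [← hp, ← hp']
      split_ifs at hp hp' ⊢ <;> omega
    · omega

/-- Two closed walks, of lengths `k * R` and `N`, combine to a helix of length `R * (N + 3 * k)`
on the product torus. The crossing from `A n` to `A (n + 1)` takes place at a position given
by the colour `c n` and carries the label `e n`; these have to separate crossings that would
otherwise come too close to each other. -/
theorem IsSpreadCycle.exists_helix {A : ℕ → α → Bool} {B : ℕ → β → Bool} {e : ℕ → Bool}
    {c : ℕ → ℕ} {k R N C : ℕ} (hk : 2 ≤ k) (hke : Even k) (hR : 1 ≤ R)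
    (hA : IsSpreadCycle (k - 1) (k * R) A) (hB : IsSpreadCycle k N B) (hN : k * (C + k) ≤ N + k)
    (hc : ∀ n, c n < C) (hcR : ∀ n, c (n + R * k) = c n) (heR : ∀ n, e (n + R * k) = e n)
    (hsep : ∀ n r, 1 ≤ r → r < R → c n = c (n + r * k) → e n = e (n + r * k) →
      k ≤ hammingDist (A n) (A (n + r * k + 1)) ∧ k ≤ hammingDist (A (n + 1)) (A (n + r * k))) :
    ∃ y : ℕ → α ⊕ β ⊕ Bool → Bool, IsSpreadCycle k (R * (N + 3 * k)) y := by
  have hC : 1 ≤ C := (Nat.zero_le _).trans_lt (hc 0)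
  obtain ⟨g, hg⟩ : ∃ g, g + 1 = C + k := ⟨C + k - 1, by omega⟩
  have hgN : k * g ≤ N := by
    rw [← hg, mul_add, mul_one] at hN
    omega
  have hNk : 2 * k ≤ N := by
    have : k * 2 ≤ k * g := Nat.mul_le_mul_left k (by omega)
    omega
  obtain ⟨b, hb0, hbstep, hbr⟩ : ∃ b : ℕ → ℕ, b 0 = 0 ∧ (∀ m, b m + g ≤ b (m + 1)) ∧
      ∀ m r, b (m + r * k) = b m + r * N := by
    refine ⟨fun m => N * (m / k) + g * (m % k), by simp, fun m => ?_, fun m r => ?_⟩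
    · have hm := Nat.mod_lt m (by omega : 0 < k)
      dsimp only
      rcases lt_or_ge (m % k + 1) k with h | h
      · have h1 : (m + 1) / k = m / k := by
          rw [Nat.succ_div, if_neg, add_zero]
          rw [Nat.dvd_iff_mod_eq_zero, Nat.add_mod, Nat.mod_eq_of_lt (by omega : 1 < k),
            Nat.mod_eq_of_lt h]
          omega
        have h2 : (m + 1) % k = m % k + 1 := by
          rw [Nat.add_mod, Nat.mod_eq_of_lt (by omega : 1 < k), Nat.mod_eq_of_lt h]
        rw [h1, h2, mul_add]
        omega
      · have h3 : m % k + 1 = k := by omega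
        have h2 : (m + 1) % k = 0 := by
          rw [Nat.add_mod, Nat.mod_eq_of_lt (by omega : 1 < k), h3, Nat.mod_self]
        have h1 : (m + 1) / k = m / k + 1 := by
          rw [Nat.succ_div, if_pos (Nat.dvd_of_mod_eq_zero h2)]
        have h4 : g * (m % k) + g = k * g := by
          conv_rhs => rw [← h3]
          ring
        rw [h1, h2, mul_add]
        omega
    · dsimp only
      rw [Nat.add_mul_mod_self_right, Nat.add_mul_div_right _ _ (by omega)]
      ring
  have hb : ∀ m n, m < n → b m + C + k ≤ b n + 1 := by
    intro m n hmn
    have hmono : Monotone b := monotone_nat_of_le_succ fun m => by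
      have := hbstep m
      omega
    have h1 := hbstep m
    have h2 := hmono (Nat.succ_le_of_lt hmn)
    rw [Nat.succ_eq_add_one] at h2
    omega
  have hlam : ∀ m n, m < n → b m + c m + k ≤ b n + c n := fun m n hmn => by
    have h1 := hb m n hmn
    have h2 := hc m
    omega
  have hlam_mono : Monotone fun m => b m + c m := monotone_nat_of_le_succ fun m => by
    have := hlam m (m + 1) (by omega)
    omega
  have hshift : ∀ {t n Q o : ℕ}, HelixState (fun m => b m + c m) t n Q o →
      HelixState (fun m => b m + c m) (t + R * (N + 3 * k)) (n + R * k) (Q + R * N) o := by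
    rintro t n Q o ⟨h1, h2, h3, h4, h5⟩
    refine ⟨by rw [h1]; ring, h2, ?_, fun ho => ?_, fun m hm => ?_⟩
    · rw [hbr, hcR]
      omega
    · have := h4 ho
      rw [hbr, hcR]
      omega
    · rcases lt_or_ge m (R * k) with h6 | h6
      · have h7 := hb m (R * k) h6
        have h8 := hbr 0 R
        have h9 := hc m
        rw [zero_add, hb0] at h8
        omega
      · obtain ⟨m, rfl⟩ := Nat.exists_eq_add_of_le' h6
        have := h5 m (by omega)
        rw [hbr, hcR]
        omega
  choose n Q o hS using HelixState.exists_state hlam_mono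
  have hnshift : ∀ t, n (t + R * (N + 3 * k)) = n t + R * k ∧
      Q (t + R * (N + 3 * k)) = Q t + R * N ∧ o (t + R * (N + 3 * k)) = o t :=
    fun t => (hS _).unique (hshift (hS t))
  obtain ⟨y, hy⟩ : ∃ y : ℕ → α ⊕ β ⊕ Bool → Bool,
      ∀ t, y t = helixVertex A B e (n t) (Q t) (o t) := ⟨_, fun _ => rfl⟩
  have hper : ∀ t, y (t + R * (N + 3 * k)) = y t := fun t => by
    obtain ⟨h1, h2, h3⟩ := hnshift t
    have hpar : (n t + R * k) % 2 = n t % 2 := by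
      have := Nat.even_iff.mp (hke.mul_left R)
      omega
    have hAper : ∀ m, A (m + R * k) = A m := fun m => by rw [mul_comm R]; exact hA.periodic m
    rw [hy, hy, h1, h2, h3]
    unfold helixVertex helixLabel
    rw [hB.apply_add_mul, heR, hpar]
    split_ifs
    · rw [add_right_comm, hAper]
    · rw [add_right_comm, hAper]
    · rw [hAper]
    · rw [hAper]
  have near : ∀ s t, s ≤ t → Q t < Q s + k → t - s ≤ hammingDist (y s) (y t) := by
    intro s t hst hQ
    rw [hy, hy]
    exact sub_le_hammingDist_helixVertex hA.step hB hNk hlam (hS s) (hS t) hst hQ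
  have hRk : 1 ≤ R * k := Nat.mul_pos hR (by omega)
  have far : ∀ s t r, 1 ≤ r → r < R → Q t < Q s + r * N + k → Q s + r * N < Q t + k →
      k ≤ hammingDist (y s) (y t) := by
    intro s t r hr hrR h1 h2
    obtain ⟨hs1, hs2, -⟩ := hnshift s
    obtain ⟨ht1, ht2, -⟩ := hnshift t
    rw [← hper s, ← hper t, hy, hy]
    exact le_hammingDist_helixVertex_of_turns hke hA hB hNk hc hb hbr hsep (hS _) (hS _) hr hrR
      (by omega) (by omega) (by omega) (by omega)
  refine ⟨y, hper, fun t => ?_, fun s t h1 h2 => ?_⟩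
  · rw [hy, hy]
    exact hammingDist_helixVertex_succ hA.step hB.step hlam_mono (hS t) (hS (t + 1))
  · have hQ1 := (hS s).pos_mono (hS t) (by omega)
    have hQ2 := (hS t).pos_mono (hS (s + R * (N + 3 * k))) (by omega)
    obtain ⟨-, hQs, -⟩ := hnshift s
    have start : Q t < Q s + k → k ≤ hammingDist (y s) (y t) := fun h => by
      have := near s t (by omega) h
      omega
    have finish : Q s + R * N < Q t + k → k ≤ hammingDist (y s) (y t) := fun h => by
      have := near t (s + R * (N + 3 * k)) (by omega) (by omega)
      rw [hper, hammingDist_comm] at this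
      omega
    have turns : ∀ r, Q t < Q s + r * N + k → Q s + r * N < Q t + k →
        k ≤ hammingDist (y s) (y t) := by
      intro r h3 h4
      rcases Nat.eq_zero_or_pos r with rfl | hr
      · exact start (by omega)
      rcases lt_or_ge r R with hrR | hrR
      · exact far s t r hr hrR h3 h4
      · have := Nat.mul_le_mul_right N hrR
        exact finish (by omega)
    obtain ⟨ρ, r, hρ, hQt⟩ : ∃ ρ r, ρ < N ∧ Q t = Q s + ρ + r * N :=
      ⟨(Q t - Q s) % N, (Q t - Q s) / N, Nat.mod_lt _ (by omega), by
        have := Nat.mod_add_div' (Q t - Q s) N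
        omega⟩
    rcases lt_or_ge ρ k with h3 | h3
    · exact turns r (by omega) (by omega)
    rcases lt_or_ge N (ρ + k) with h4 | h4
    · have : (r + 1) * N = r * N + N := by ring
      exact turns (r + 1) (by omega) (by omega)
    · rw [hy, hy, hammingDist_helixVertex, hQt, hB.apply_add_mul]
      have := hB.spread (Q s) (Q s + ρ) (by omega) (by omega)
      omega

end Helix

/-- The lower bound on `K` coming from combining two rotation cycles. -/
theorem mul_add_le_K {b k : ℕ} (hk : 2 ≤ k) (hke : Even k) (hb : (k + 2) ^ 2 ≤ b) :
    k * (b + k) ≤ K b k := by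
  obtain ⟨h, hh⟩ := hke.two_dvd
  have hsq : (k + 2) ^ 2 = k * k + 4 * k + 4 := by ring
  have hkh : 2 * (k * h) = k * k := by
    conv_rhs => rw [hh]
    rw [hh]
    ring
  have hkk : 2 * k ≤ k * k := Nat.mul_le_mul_right k hk
  obtain ⟨b', hb'⟩ : ∃ b', b = k * h + b' + 2 := ⟨b - 2 - k * h, by omega⟩
  have hA : IsSpreadCycle k (k * k) (rotationCycle (k * h)) := by
    have := isSpreadCycle_rotationCycle (b := k * h) (by omega)
    rw [hkh] at this
    exact this.mono (by omega) (by omega)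
  have hB : IsSpreadCycle k (2 * b') (rotationCycle b') :=
    (isSpreadCycle_rotationCycle (by omega)).mono (by omega) (by omega)
  obtain ⟨y, hy⟩ := IsSpreadCycle.exists_helix (e := fun n => decide (n / k % 2 = 1))
    (c := fun _ => 0) (R := k) (C := 1) hk hke (by omega) (hA.mono (by omega) (by omega)) hB
    (by rw [mul_add]; omega) (fun _ => Nat.one_pos) (fun _ => rfl)
    (fun n => by
      simp only [Nat.add_mul_div_right n k (by omega : 0 < k)]
      congr 1
      have := Nat.even_iff.mp hke
      simp only [eq_iff_iff]
      omega)
    (fun n r hr hrk _ he => by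
      simp only [Nat.add_mul_div_right n r (by omega : 0 < k), decide_eq_decide] at he
      have hk2 := Nat.even_iff.mp hke
      have h1 : 2 * k ≤ r * k := Nat.mul_le_mul_right k (by omega)
      have h2 : (r + 2) * k ≤ k * k := Nat.mul_le_mul_right k (by omega)
      rw [add_mul] at h2
      exact ⟨hA.spread _ _ (by omega) (by omega), hA.spread _ _ (by omega) (by omega)⟩)
  refine le_trans ?_ (hy.length_le_K (by omega) ?_ ?_ (d := b) ?_)
  · exact Nat.mul_le_mul_left k (by omega)
  · exact mul_comm k 2 ▸ Nat.mul_le_mul_left k (by omega)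
  · have : 2 * 6 ≤ k * (2 * b' + 3 * k) := Nat.mul_le_mul hk (by omega)
    omega
  · simp only [Fintype.card_sum, Fintype.card_fin, Fintype.card_bool]
    omega

theorem two_mul_le_K {a l : ℕ} (hl : 1 ≤ l) (hla : l ≤ a) (ha : 2 ≤ a) : 2 * a ≤ K a l :=
  ((isSpreadCycle_rotationCycle (by omega)).mono (by omega) hla).length_le_K hl (by omega)
    (by omega) (Fintype.card_fin a)

/-- A closed walk can be coloured by the directions of its steps, with the value of the changing
coordinate as a label, in such a way that steps of equal colour and label are separated. -/
theorem IsSpreadCycle.exists_colouring {ι : Type*} [Fintype ι] {l L : ℕ} {A : ℕ → ι → Bool}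
    (hA : IsSpreadCycle l L A) :
    ∃ (c : ℕ → ℕ) (e : ℕ → Bool), (∀ n, c n < Fintype.card ι) ∧ (∀ n, c (n + L) = c n) ∧
      (∀ n, e (n + L) = e n) ∧ ∀ s t, c s = c t → e s = e t →
        hammingDist (A s) (A (t + 1)) = hammingDist (A s) (A t) + 1 ∧
        hammingDist (A (s + 1)) (A t) = hammingDist (A s) (A t) + 1 := by
  choose i hi hj using fun n => exists_flip_of_hammingDist_eq_one (hA.step n)
  have hiper : ∀ n, i (n + L) = i n := fun n => by
    by_contra hne
    have := hj n _ hne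
    rw [← hA.periodic n, ← hA.periodic (n + 1), add_right_comm] at this
    exact hi _ this
  refine ⟨fun n => Fintype.equivFin ι (i n), fun n => A n (i n), fun n => Fin.is_lt _,
    fun n => by simp only [hiper], fun n => by simp only [hiper, hA.periodic], ?_⟩
  intro s t hc he
  have hst : i s = i t := (Fintype.equivFin ι).injective (Fin.ext hc)
  dsimp only at he
  refine ⟨hammingDist_flip (i := i t) (by rw [← he, hst]) (hi t) (hj t), ?_⟩
  rw [hammingDist_comm, hammingDist_comm (A s)]
  exact hammingDist_flip (i := i s) (by rw [he, hst]) (hi s) (hj s)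

/-- For even `k ≥ 2` and `n ≥ m ≥ (k+2)² + 3`,
`K(m−3,k−1)·K(n−3,k) ≤ k·K(m+n−3,k)`. -/
theorem stmt_5 (k m n : ℕ) (hk : 2 ≤ k) (hke : Even k)
    (hm : (k + 2) ^ 2 + 3 ≤ m) (hmn : m ≤ n) :
    K (m - 3) (k - 1) * K (n - 3) k ≤ k * K (m + n - 3) k := by
  obtain ⟨a, rfl⟩ : ∃ a, m = a + 3 := Nat.exists_eq_add_of_le' (by omega)
  obtain ⟨b, rfl⟩ : ∃ b, n = b + 3 := Nat.exists_eq_add_of_le' (by omega)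
  rw [Nat.add_sub_cancel, Nat.add_sub_cancel, show a + 3 + (b + 3) - 3 = a + 1 + (b + 2) by omega]
  have hsq : (k + 2) ^ 2 = k * k + 4 * k + 4 := by ring
  have hM : 2 * a ≤ K a (k - 1) := two_mul_le_K (by omega) (by omega) (by omega)
  have hN : k * (b + k) ≤ K b k := mul_add_le_K hk hke (by omega)
  have hNb : 2 * (b + k) ≤ k * (b + k) := Nat.mul_le_mul_right _ hk
  obtain ⟨A₀, hA₀⟩ := exists_isSpreadCycle_K (d := a) (k := k - 1) (by omega)
  obtain ⟨B, hB⟩ := exists_isSpreadCycle_K (d := b) (k := k) (by omega)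
  generalize K a (k - 1) = M at *
  generalize K b k = N at *
  obtain ⟨R, r, hrk, hMr⟩ : ∃ R r, r < k ∧ M + r = k * R := by
    refine ⟨(M + (k - 1)) / k, (k - 1) - (M + (k - 1)) % k, by omega, ?_⟩
    have h1 := Nat.mod_add_div (M + (k - 1)) k
    have h2 := Nat.mod_lt (M + (k - 1)) (by omega : 0 < k)
    omega
  have hMe := hA₀.even_length
  have hre : Even r := (Nat.even_add.mp (hMr ▸ hke.mul_right R)).mp hMe
  have hrM : r * (k - 1) ≤ k * k := Nat.mul_le_mul hrk.le (by omega)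
  obtain ⟨A, hA⟩ := hA₀.exists_lengthen (by omega) hre (by omega) (by omega)
  obtain ⟨c, e, hc, hcper, heper, hce⟩ := hA.exists_colouring
  rw [hMr] at hA hcper heper
  have hR : 1 ≤ R := by
    by_contra hcon
    obtain rfl : R = 0 := by omega
    omega
  obtain ⟨y, hy⟩ := hA.exists_helix hk hke hR hB
    (C := a + 1) (c := c) (e := e) (by
      have : k * (a + k) ≤ k * (b + k) := Nat.mul_le_mul_left k (by omega)
      rw [add_right_comm, mul_add, mul_one]
      omega)
    (by simpa using hc) (by simpa only [mul_comm R] using hcper)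
    (by simpa only [mul_comm R] using heper)
    (fun n r hr hrR h1 h2 => by
      obtain ⟨h3, h4⟩ := hce _ _ h1 h2
      have h5 : 1 * k ≤ r * k := Nat.mul_le_mul_right k hr
      have h6 : (r + 1) * k ≤ R * k := Nat.mul_le_mul_right k hrR
      rw [add_mul, mul_comm R] at h6
      have h7 := hA.spread n (n + r * k) (by omega) (by omega)
      omega)
  have hlen : 1 * (N + 3 * k) ≤ R * (N + 3 * k) := Nat.mul_le_mul_right _ hR
  calc M * N ≤ (M + r) * (N + 3 * k) := Nat.mul_le_mul (by omega) (by omega)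
    _ = k * (R * (N + 3 * k)) := by rw [hMr, mul_assoc]
    _ ≤ _ := Nat.mul_le_mul_left k (hy.length_le_K (by omega) (by omega) (by omega) (by simp))
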